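/- arXiv:math/0101181 — 2 statements merged into one kernel-verified Lean document; each statement's English description precedes it below -/
import Mathlib

section
/- Let L be a Dirac structure of E^1(M) and suppose Γ(L) contains an element of the form (Y_a, θ_a) + (da, 0) where a ∈ C^∞(M) is nowhere vanishing. Then for any two L-admissible functions f and g, the products af and ag are L-admissible, and the bracket {f,g}^a := (1/a){af, ag} defines a second Lie algebra structure on the space A^∞(L) of L-admissible functions, alongside the Lie bracket {.,.}. -/
/-!
Algebraic model of the Cartan calculus of a smooth manifold `M`:
`R` models the ring of smooth functions `C^∞(M)`, `V` the vector fields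
`Γ(TM)`, and `Ω1, Ω2, Ω3` the modules of differential forms of degree
1, 2, 3.  `lie` is the Lie bracket of vector fields, `d0, d1, d2` the
exterior differentials, `ι1, ι2, ι3` the interior products and
`w11, w12` the wedge products, together with their standard identities
(Leibniz rules, skew-symmetry, the evaluation formulas for `dα`, `dω`,
and nondegeneracy of the interior-product pairings).
Sections of `TM ⊕ T*M` are modeled by `V × Ω1` and sections of
`E^1(M) = (TM × ℝ) ⊕ (T*M × ℝ)` by `(V × R) × (Ω1 × R)`; sub-bundles
are modeled by their `R`-modules of sections.
-/

namespace ConformalDirac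

noncomputable section

structure CartanCalculus (R V Ω1 Ω2 Ω3 : Type*) [CommRing R] [Algebra ℝ R]
    [AddCommGroup V] [Module ℝ V] [Module R V] [IsScalarTower ℝ R V]
    [AddCommGroup Ω1] [Module ℝ Ω1] [Module R Ω1] [IsScalarTower ℝ R Ω1]
    [AddCommGroup Ω2] [Module ℝ Ω2] [Module R Ω2] [IsScalarTower ℝ R Ω2]
    [AddCommGroup Ω3] [Module ℝ Ω3] [Module R Ω3] [IsScalarTower ℝ R Ω3] where
  lie : V →ₗ[ℝ] V →ₗ[ℝ] V
  d0 : R →ₗ[ℝ] Ω1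
  d1 : Ω1 →ₗ[ℝ] Ω2
  d2 : Ω2 →ₗ[ℝ] Ω3
  ι1 : V →ₗ[ℝ] Ω1 →ₗ[ℝ] R
  ι2 : V →ₗ[ℝ] Ω2 →ₗ[ℝ] Ω1
  ι3 : V →ₗ[ℝ] Ω3 →ₗ[ℝ] Ω2
  w11 : Ω1 →ₗ[ℝ] Ω1 →ₗ[ℝ] Ω2
  w12 : Ω1 →ₗ[ℝ] Ω2 →ₗ[ℝ] Ω3
  lie_skew : ∀ X Y, lie X Y = - lie Y X
  lie_jacobi : ∀ X Y Z, lie (lie X Y) Z + lie (lie Y Z) X + lie (lie Z X) Y = 0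
  lie_smul : ∀ (f : R) (X Y : V), lie X (f • Y) = f • lie X Y + (ι1 X (d0 f)) • Y
  ι1_smul_left : ∀ (f : R) X α, ι1 (f • X) α = f * ι1 X α
  ι1_smul_right : ∀ (f : R) X α, ι1 X (f • α) = f * ι1 X α
  ι2_smul_left : ∀ (f : R) X ω, ι2 (f • X) ω = f • ι2 X ω
  ι2_smul_right : ∀ (f : R) X ω, ι2 X (f • ω) = f • ι2 X ω
  ι3_smul_left : ∀ (f : R) X θ, ι3 (f • X) θ = f • ι3 X θ
  ι3_smul_right : ∀ (f : R) X θ, ι3 X (f • θ) = f • ι3 X θ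
  d0_mul : ∀ f g : R, d0 (f * g) = f • d0 g + g • d0 f
  d1_d0 : ∀ f : R, d1 (d0 f) = 0
  d2_d1 : ∀ α, d2 (d1 α) = 0
  d1_smul : ∀ (f : R) α, d1 (f • α) = f • d1 α + w11 (d0 f) α
  d2_smul : ∀ (f : R) ω, d2 (f • ω) = f • d2 ω + w12 (d0 f) ω
  w11_skew : ∀ α β, w11 α β = - w11 β α
  w11_smul_left : ∀ (f : R) α β, w11 (f • α) β = f • w11 α β
  w12_smul_left : ∀ (f : R) α ω, w12 (f • α) ω = f • w12 α ω
  w12_smul_right : ∀ (f : R) α ω, w12 α (f • ω) = f • w12 α ω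
  ι2_w11 : ∀ X α β, ι2 X (w11 α β) = (ι1 X α) • β - (ι1 X β) • α
  ι3_w12 : ∀ X α ω, ι3 X (w12 α ω) = (ι1 X α) • ω - w11 α (ι2 X ω)
  ι2_skew : ∀ X Y ω, ι1 Y (ι2 X ω) = - ι1 X (ι2 Y ω)
  ι3_skew : ∀ X Y θ, ι2 Y (ι3 X θ) = - ι2 X (ι3 Y θ)
  eval_d1 : ∀ X Y α, ι1 Y (ι2 X (d1 α)) =
      ι1 X (d0 (ι1 Y α)) - ι1 Y (d0 (ι1 X α)) - ι1 (lie X Y) α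
  eval_d2 : ∀ X Y Z ω, ι1 Z (ι2 Y (ι3 X (d2 ω))) =
      ι1 X (d0 (ι1 Z (ι2 Y ω))) - ι1 Y (d0 (ι1 Z (ι2 X ω)))
        + ι1 Z (d0 (ι1 Y (ι2 X ω)))
        - ι1 Z (ι2 (lie X Y) ω) + ι1 Y (ι2 (lie X Z) ω) - ι1 X (ι2 (lie Y Z) ω)
  ι1_nondeg_vec : ∀ X, (∀ α, ι1 X α = 0) → X = 0
  ι1_nondeg_form : ∀ α, (∀ X, ι1 X α = 0) → α = 0
  ι2_nondeg : ∀ ω, (∀ X, ι2 X ω = 0) → ω = 0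
  ι3_nondeg : ∀ θ, (∀ X, ι3 X θ = 0) → θ = 0

namespace CartanCalculus

variable {R V Ω1 Ω2 Ω3 : Type*} [CommRing R] [Algebra ℝ R]
    [AddCommGroup V] [Module ℝ V] [Module R V] [IsScalarTower ℝ R V]
    [AddCommGroup Ω1] [Module ℝ Ω1] [Module R Ω1] [IsScalarTower ℝ R Ω1]
    [AddCommGroup Ω2] [Module ℝ Ω2] [Module R Ω2] [IsScalarTower ℝ R Ω2]
    [AddCommGroup Ω3] [Module ℝ Ω3] [Module R Ω3] [IsScalarTower ℝ R Ω3]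
    (C : CartanCalculus R V Ω1 Ω2 Ω3)

/-- `X ⬝ f = i_X (df)`, the action of a vector field on a function. -/
def Xdot (X : V) (f : R) : R := C.ι1 X (C.d0 f)

/-- Lie derivative of a 1-form, via Cartan's magic formula
`L_X α = d (i_X α) + i_X (dα)`. -/
def lieD (X : V) (α : Ω1) : Ω1 := C.d0 (C.ι1 X α) + C.ι2 X (C.d1 α)

/-- The Courant bracket on sections of `TM ⊕ T*M`:
`[X1+α1, X2+α2]_c = [X1,X2] + L_{X1}α2 − L_{X2}α1 + (1/2) d(i_{X2}α1 − i_{X1}α2)`. -/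
def courant (e1 e2 : V × Ω1) : V × Ω1 :=
  (C.lie e1.1 e2.1,
    C.lieD e1.1 e2.2 - C.lieD e2.1 e1.2
      + (2⁻¹ : ℝ) • C.d0 (C.ι1 e2.1 e1.2 - C.ι1 e1.1 e2.2))

/-- The canonical symmetric pairing on `TM ⊕ T*M`:
`⟨X1+α1, X2+α2⟩_+ = (1/2)(i_{X2}α1 + i_{X1}α2)`. -/
def pairPlus (e1 e2 : V × Ω1) : R :=
  (2⁻¹ : ℝ) • (C.ι1 e2.1 e1.2 + C.ι1 e1.1 e2.2)

/-- A sub-bundle of `TM ⊕ T*M` (given by its module of sections) is isotropic. -/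
def IsIsotropicT (L : Submodule R (V × Ω1)) : Prop :=
  ∀ e1 ∈ L, ∀ e2 ∈ L, C.pairPlus e1 e2 = 0

/-- Maximally isotropic sub-bundle of `TM ⊕ T*M`. -/
def IsMaxIsotropicT (L : Submodule R (V × Ω1)) : Prop :=
  C.IsIsotropicT L ∧ ∀ e, (∀ e' ∈ L, C.pairPlus e e' = 0) → e ∈ L

/-- A Dirac structure on `M`: a maximally isotropic sub-bundle of `TM ⊕ T*M`
whose sections are closed under the Courant bracket. -/
def IsDiracT (L : Submodule R (V × Ω1)) : Prop :=
  C.IsMaxIsotropicT L ∧ ∀ e1 ∈ L, ∀ e2 ∈ L, C.courant e1 e2 ∈ L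

/-! Sections of `E^1(M) = (TM × ℝ) ⊕ (T*M × ℝ)` are modeled by
`(V × R) × (Ω1 × R)`; an element `((X,f),(α,g))` is the section
`(X,f)+(α,g)` of the paper. -/

/-- The canonical symmetric pairing on `E^1(M)`:
`⟨(X1,μ1)+(α1,λ1), (X2,μ2)+(α2,λ2)⟩_+
  = (1/2)(i_{X2}α1 + i_{X1}α2 + λ1 μ2 + λ2 μ1)`. -/
def pairPlusE (e1 e2 : (V × R) × (Ω1 × R)) : R :=
  (2⁻¹ : ℝ) • (C.ι1 e2.1.1 e1.2.1 + C.ι1 e1.1.1 e2.2.1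
      + e1.2.2 * e2.1.2 + e2.2.2 * e1.1.2)

/-- The skew-symmetric pairing on `E^1(M)`:
`⟨(X1,μ1)+(α1,λ1), (X2,μ2)+(α2,λ2)⟩_−
  = (1/2)(i_{X2}α1 − i_{X1}α2 + λ1 μ2 − λ2 μ1)`. -/
def pairMinusE (e1 e2 : (V × R) × (Ω1 × R)) : R :=
  (2⁻¹ : ℝ) • (C.ι1 e2.1.1 e1.2.1 - C.ι1 e1.1.1 e2.2.1
      + e1.2.2 * e2.1.2 - e2.2.2 * e1.1.2)

/-- The extended Courant bracket on sections of `E^1(M)`. -/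
def ebracket (e1 e2 : (V × R) × (Ω1 × R)) : (V × R) × (Ω1 × R) :=
  ((C.lie e1.1.1 e2.1.1, C.Xdot e1.1.1 e2.1.2 - C.Xdot e2.1.1 e1.1.2),
   (C.lieD e1.1.1 e2.2.1 - C.lieD e2.1.1 e1.2.1
      + (2⁻¹ : ℝ) • C.d0 (C.ι1 e2.1.1 e1.2.1 - C.ι1 e1.1.1 e2.2.1)
      + e1.1.2 • e2.2.1 - e2.1.2 • e1.2.1
      + (2⁻¹ : ℝ) • (e2.2.2 • C.d0 e1.1.2 - e1.2.2 • C.d0 e2.1.2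
          - e1.1.2 • C.d0 e2.2.2 + e2.1.2 • C.d0 e1.2.2),
    C.Xdot e1.1.1 e2.2.2 - C.Xdot e2.1.1 e1.2.2
      + (2⁻¹ : ℝ) • (C.ι1 e2.1.1 e1.2.1 - C.ι1 e1.1.1 e2.2.1
          - e2.1.2 * e1.2.2 + e1.1.2 * e2.2.2)))

/-- Isotropic sub-bundle of `E^1(M)`. -/
def IsIsotropicE (L : Submodule R ((V × R) × (Ω1 × R))) : Prop :=
  ∀ e1 ∈ L, ∀ e2 ∈ L, C.pairPlusE e1 e2 = 0

/-- Maximally isotropic sub-bundle of `E^1(M)`. -/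
def IsMaxIsotropicE (L : Submodule R ((V × R) × (Ω1 × R))) : Prop :=
  C.IsIsotropicE L ∧ ∀ e, (∀ e' ∈ L, C.pairPlusE e e' = 0) → e ∈ L

/-- A Dirac structure of `E^1(M)`: a maximally isotropic sub-bundle whose
sections are closed under the extended Courant bracket. -/
def IsDiracE (L : Submodule R ((V × R) × (Ω1 × R))) : Prop :=
  C.IsMaxIsotropicE L ∧ ∀ e1 ∈ L, ∀ e2 ∈ L, C.ebracket e1 e2 ∈ L

/-- `f` is `L`-admissible: there are `X_f`, `φ_f` with
`(X_f, φ_f) + (df, f) ∈ Γ(L)`. -/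
def IsAdmissible (L : Submodule R ((V × R) × (Ω1 × R))) (f : R) : Prop :=
  ∃ (Xf : V) (φf : R), ((Xf, φf), (C.d0 f, f)) ∈ L

/-- `e` is a section of `L` of the form `e_f = (X_f, φ_f) + (df, f)`
witnessing admissibility of `f`. -/
def AdmSec (L : Submodule R ((V × R) × (Ω1 × R))) (f : R)
    (e : (V × R) × (Ω1 × R)) : Prop :=
  e ∈ L ∧ e.2.1 = C.d0 f ∧ e.2.2 = f

/-- The Koszul bracket of 1-forms associated to a bivector `π`:
`[α,β]_π = L_{πα}β − L_{πβ}α − d(π(α,β))`. -/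
def koszul (π : Ω1 →ₗ[R] V) (α β : Ω1) : Ω1 :=
  C.lieD (π α) β - C.lieD (π β) α - C.d0 (C.ι1 (π α) β)

/-- `π` is a skew-symmetric bivector: `i_{πα}β = −i_{πβ}α`, i.e.
`π(α,β) = −π(β,α)`. -/
def IsSkewBivector (π : Ω1 →ₗ[R] V) : Prop :=
  ∀ α β, C.ι1 (π α) β = - C.ι1 (π β) α

/-- `[π,π]_s = 0` (the Schouten–Nijenhuis square of `π` vanishes), expressed
through the standard equivalent identity `π [α,β]_π = [πα, πβ]`. -/
def IsPoissonBivector (π : Ω1 →ₗ[R] V) : Prop :=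
  ∀ α β, π (C.koszul π α β) = C.lie (π α) (π β)

/-- `(π, E)` is a Jacobi structure: `[E,π]_s = 0` and `[π,π]_s = 2 E ∧ π`.
The first condition is expressed through `[E,π]_s α = [E,πα] − π(L_E α)`;
the second through the evaluation of `(1/2)[π,π]_s(α,β,γ)
 = ⟨[πα,πβ] − π[α,β]_π, γ⟩` against `(E ∧ π)(α,β,γ)`. -/
def IsJacobiPair (π : Ω1 →ₗ[R] V) (E : V) : Prop :=
  (∀ α, C.lie E (π α) - π (C.lieD E α) = 0) ∧
  (∀ α β γ, C.ι1 (C.lie (π α) (π β) - π (C.koszul π α β)) γ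
      = C.ι1 E α * C.ι1 (π β) γ - C.ι1 E β * C.ι1 (π α) γ
        + C.ι1 E γ * C.ι1 (π α) β)

/-- The graph of the bundle map `P(α,g) = (πα + gE, −i_E α)` associated to a
pair `(π, E)`, as a sub-bundle of `E^1(M)`. -/
def jacobiGraph (π : Ω1 →ₗ[R] V) (E : V) :
    Submodule R ((V × R) × (Ω1 × R)) :=
  Submodule.span R
    {e : (V × R) × (Ω1 × R) |
      e.1.1 = π e.2.1 + e.2.2 • E ∧ e.1.2 = -(C.ι1 E e.2.1)}

/-- The twist `(X,φ)+(α,f) ↦ (aX + fY, aφ − i_Y α) + (α,f)`. -/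
def twistFun (a : R) (Y : V) (e : (V × R) × (Ω1 × R)) :
    (V × R) × (Ω1 × R) :=
  ((a • e.1.1 + e.2.2 • Y, a * e.1.2 - C.ι1 Y e.2.1), e.2)

/-- The sub-bundle of `E^1(M)` spanned by the `(a,Y)`-twists of the sections
of `L`. -/
def conf (L : Submodule R ((V × R) × (Ω1 × R))) (a : R) (Y : V) :
    Submodule R ((V × R) × (Ω1 × R)) :=
  Submodule.span R (C.twistFun a Y '' (L : Set ((V × R) × (Ω1 × R))))

end CartanCalculus
end
end ConformalDirac

namespace ConformalDirac

variable {R V Ω1 Ω2 Ω3 : Type*} [CommRing R] [Algebra ℝ R]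
    [AddCommGroup V] [Module ℝ V] [Module R V] [IsScalarTower ℝ R V]
    [AddCommGroup Ω1] [Module ℝ Ω1] [Module R Ω1] [IsScalarTower ℝ R Ω1]
    [AddCommGroup Ω2] [Module ℝ Ω2] [Module R Ω2] [IsScalarTower ℝ R Ω2]
    [AddCommGroup Ω3] [Module ℝ Ω3] [Module R Ω3] [IsScalarTower ℝ R Ω3]
    (C : CartanCalculus R V Ω1 Ω2 Ω3)


namespace CartanCalculus

variable {C}

lemma ι1_d0_mul (X : V) (f g : R) :
    C.ι1 X (C.d0 (f * g)) = f * C.ι1 X (C.d0 g) + g * C.ι1 X (C.d0 f) := by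
  rw [C.d0_mul, map_add, C.ι1_smul_right, C.ι1_smul_right]

lemma ι1_lie_d0 (X Y : V) (f : R) :
    C.ι1 (C.lie X Y) (C.d0 f)
      = C.ι1 X (C.d0 (C.ι1 Y (C.d0 f))) - C.ι1 Y (C.d0 (C.ι1 X (C.d0 f))) := by
  have h := C.eval_d1 X Y (C.d0 f)
  rw [C.d1_d0, map_zero, map_zero] at h
  linear_combination h

lemma pairMinusE_swap (e1 e2 : (V × R) × (Ω1 × R)) :
    C.pairMinusE e1 e2 = -C.pairMinusE e2 e1 := by
  simp only [pairMinusE]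
  module

lemma pairMinusE_neg_right (e1 e2 : (V × R) × (Ω1 × R)) :
    C.pairMinusE e1 (-e2) = -C.pairMinusE e1 e2 := by
  simp only [pairMinusE, Prod.fst_neg, Prod.snd_neg, map_neg, LinearMap.neg_apply, neg_mul, mul_neg]
  module

lemma ebracket_swap (e1 e2 : (V × R) × (Ω1 × R)) :
    C.ebracket e1 e2 = -C.ebracket e2 e1 := by
  refine Prod.ext (Prod.ext (C.lie_skew _ _) ?_) (Prod.ext ?_ ?_) <;>
    simp only [ebracket, Prod.fst_neg, Prod.snd_neg, map_sub] <;> module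

/-- On an isotropic sub-bundle the skew-symmetric pairing is computed by either half. -/
lemma IsIsotropicE.pairMinusE_eq {L : Submodule R ((V × R) × (Ω1 × R))}
    (hL : C.IsIsotropicE L) {e1 e2 : (V × R) × (Ω1 × R)} (h1 : e1 ∈ L) (h2 : e2 ∈ L) :
    C.pairMinusE e1 e2 = -(C.ι1 e1.1.1 e2.2.1 + e2.2.2 * e1.1.2) := by
  have h := hL e1 h1 e2 h2
  simp only [pairPlusE] at h
  rw [← sub_eq_zero, ← h, pairMinusE]
  module

namespace AdmSec

variable {L : Submodule R ((V × R) × (Ω1 × R))} {f g h : R}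
  {ef eg eh : (V × R) × (Ω1 × R)}

lemma isAdmissible (hf : C.AdmSec L f ef) : C.IsAdmissible L f := by
  refine ⟨ef.1.1, ef.1.2, ?_⟩
  rw [← hf.2.1, ← hf.2.2]
  exact hf.1

/-- The section `a e_f + f e_a` of a product `af`. -/
lemma smul_add {a : R} {ea : (V × R) × (Ω1 × R)} (ha : ea ∈ L)
    (hda : ea.2.1 = C.d0 a) (hza : ea.2.2 = 0) (hf : C.AdmSec L f ef) :
    C.AdmSec L (a * f) (a • ef + f • ea) := by
  refine ⟨L.add_mem (L.smul_mem _ hf.1) (L.smul_mem _ ha), ?_, ?_⟩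
  · simp [hf.2.1, hda, C.d0_mul]
  · simp [hf.2.2, hza]

/-- If `af` is admissible and `a` is invertible, then `f` is admissible. -/
lemma of_mul {a ainv : R} (hinv : a * ainv = 1) {ea : (V × R) × (Ω1 × R)} (ha : ea ∈ L)
    (hda : ea.2.1 = C.d0 a) (hza : ea.2.2 = 0) (hf : C.AdmSec L (a * f) ef) :
    C.AdmSec L f (ainv • (ef - f • ea)) := by
  have hinv' : ainv * a = 1 := by rw [mul_comm, hinv]
  refine ⟨L.smul_mem _ (L.sub_mem hf.1 (L.smul_mem _ ha)), ?_, ?_⟩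
  · simp [hf.2.1, hda, C.d0_mul, smul_smul, hinv']
  · simp [hf.2.2, hza, ← mul_assoc, hinv']

/-- `[e_f, e_g]` is a section of the form `e_{{f,g}}`. -/
lemma ebracket (hL : C.IsDiracE L) (hf : C.AdmSec L f ef) (hg : C.AdmSec L g eg) :
    C.AdmSec L (-(C.pairMinusE ef eg)) (C.ebracket ef eg) := by
  have half : algebraMap ℝ R 2⁻¹ * 2 = 1 := by
    rw [← map_ofNat (algebraMap ℝ R) 2, ← map_mul]
    norm_num
  refine ⟨hL.2 _ hf.1 _ hg.1, ?_, ?_⟩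
  · simp only [CartanCalculus.ebracket, pairMinusE, lieD, hf.2.1, hg.2.1, hf.2.2, hg.2.2,
      C.d1_d0, map_zero, map_neg, map_smul, map_add, map_sub, C.d0_mul]
    simp only [algebra_compatible_smul R (2⁻¹ : ℝ)]
    match_scalars <;> grind
  · simp only [CartanCalculus.ebracket, pairMinusE, Xdot, hf.2.1, hg.2.1, hf.2.2, hg.2.2,
      Algebra.smul_def]
    linear_combination (C.ι1 eg.1.1 (C.d0 f) - C.ι1 ef.1.1 (C.d0 g)) * half

/-- The Jacobi identity for the bracket `{f,g} = -⟨e_f, e_g⟩_-`. -/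
lemma jacobi (hL : C.IsDiracE L) (hf : C.AdmSec L f ef) (hg : C.AdmSec L g eg)
    (hh : C.AdmSec L h eh) :
    C.pairMinusE (C.ebracket ef eg) eh + C.pairMinusE (C.ebracket eg eh) ef
      + C.pairMinusE (C.ebracket eh ef) eg = 0 := by
  have iso := hL.1.1
  have key := iso.pairMinusE_eq (ebracket hL hf hg).1 hh.1
  have hgh := iso.pairMinusE_eq hg.1 hh.1
  have hhf := iso.pairMinusE_eq hf.1 hh.1
  have hg' := iso.pairMinusE_eq hf.1 (ebracket hL hg hh).1
  have hh' := iso.pairMinusE_eq hg.1 (ebracket hL hh hf).1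
  rw [(ebracket hL hg hh).2.1, (ebracket hL hg hh).2.2, hgh] at hg'
  rw [(ebracket hL hh hf).2.1, (ebracket hL hh hf).2.2, pairMinusE_swap eh ef, hhf] at hh'
  rw [pairMinusE_swap (C.ebracket eg eh), pairMinusE_swap (C.ebracket eh ef), key, hg', hh']
  simp only [CartanCalculus.ebracket, Xdot, hh.2.1, hh.2.2, ι1_lie_d0, map_neg, map_add,
    ι1_d0_mul]
  ring

end AdmSec

end CartanCalculus

/-- Theorem 6.1: let `L` be a Dirac structure of `E^1(M)`
and suppose `Γ(L)` contains `(Y_a,θ_a)+(da,0)` with `a` nowhere vanishing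
(i.e. invertible, with inverse `ainv`).  Then the products `af` of admissible
functions by `a` are admissible, and `A^∞(L)` carries two Lie brackets:
`{.,.}` and `{f,g}^a = (1/a){af,ag}` (here `{af,ag}` is computed through the
sections `a•e_f + f•e_a`, and the section of `{af₁,af₂}` needed for
iterated brackets is `[e_{af₁}, e_{af₂}]`): both satisfy closedness and the
Jacobi identity. -/
theorem conformal_bracket_lie (L : Submodule R ((V × R) × (Ω1 × R)))
    (hL : C.IsDiracE L) (a ainv : R) (ha : a * ainv = 1) (Ya : V) (θa : R)
    (hea : ((Ya, θa), (C.d0 a, (0 : R))) ∈ L) :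
    (∀ f : R, C.IsAdmissible L f → C.IsAdmissible L (a * f))
    ∧ (∀ (f g : R) (ef eg), C.AdmSec L f ef → C.AdmSec L g eg →
        C.IsAdmissible L (ainv * (-(C.pairMinusE
            (a • ef + f • ((Ya, θa), (C.d0 a, (0 : R))))
            (a • eg + g • ((Ya, θa), (C.d0 a, (0 : R))))))))
    ∧ (∀ (f g h : R) (ef eg eh),
        C.AdmSec L f ef → C.AdmSec L g eg → C.AdmSec L h eh →
          -(C.pairMinusE ef (C.ebracket eg eh))
            - (-(C.pairMinusE eg (C.ebracket ef eh)))
            + (-(C.pairMinusE eh (C.ebracket ef eg))) = 0)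
    ∧ (∀ (f1 f2 f3 : R) (e1 e2 e3),
        C.AdmSec L f1 e1 → C.AdmSec L f2 e2 → C.AdmSec L f3 e3 →
          ainv * (-(C.pairMinusE
              (C.ebracket (a • e1 + f1 • ((Ya, θa), (C.d0 a, (0 : R))))
                (a • e2 + f2 • ((Ya, θa), (C.d0 a, (0 : R)))))
              (a • e3 + f3 • ((Ya, θa), (C.d0 a, (0 : R))))))
          + ainv * (-(C.pairMinusE
              (C.ebracket (a • e2 + f2 • ((Ya, θa), (C.d0 a, (0 : R))))
                (a • e3 + f3 • ((Ya, θa), (C.d0 a, (0 : R)))))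
              (a • e1 + f1 • ((Ya, θa), (C.d0 a, (0 : R))))))
          + ainv * (-(C.pairMinusE
              (C.ebracket (a • e3 + f3 • ((Ya, θa), (C.d0 a, (0 : R))))
                (a • e1 + f1 • ((Ya, θa), (C.d0 a, (0 : R)))))
              (a • e2 + f2 • ((Ya, θa), (C.d0 a, (0 : R))))))
          = 0) := by
  have hadm := fun {f : R} {e} (he : C.AdmSec L f e) => he.smul_add hea rfl rfl
  refine ⟨?_, ?_, ?_, ?_⟩
  · rintro f ⟨X, φ, hf⟩
    exact (hadm ⟨hf, rfl, rfl⟩).isAdmissible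
  · intro f g ef eg hf hg
    have hbr := (hadm hf).ebracket hL (hadm hg)
    rw [← one_mul (-_), ← ha, mul_assoc] at hbr
    exact (hbr.of_mul ha hea rfl rfl).isAdmissible
  · intro f g h ef eg eh hf hg hh
    have hskew := CartanCalculus.pairMinusE_swap (C := C)
    have hjac := hf.jacobi hL hg hh
    rw [hskew ef, hskew eh, CartanCalculus.ebracket_swap ef eh,
      CartanCalculus.pairMinusE_neg_right, hskew eg]
    linear_combination hjac
  · intro f1 f2 f3 e1 e2 e3 h1 h2 h3
    linear_combination -ainv * (hadm h1).jacobi hL (hadm h2) (hadm h3)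

end ConformalDirac
end

section
/- Let L be a Dirac structure of E^1(M) whose smooth sections are locally spanned by elements of the form (X_f, φ_f)+(df, f). Let a ∈ C^∞(M) be nowhere vanishing with (Y_a, θ_a)+(da,0) ∈ Γ(L), and let L^a be the sub-bundle with fibre at x spanned by { ((aX + f Y_a)_x, (aφ − i_{Y_a} α)_x) + (α_x, f_x) | (X,φ)+(α,f) ∈ Γ(L) }. Then L^a is a Dirac structure of E^1(M). -/
namespace ConformalDirac

variable {R V Ω1 Ω2 Ω3 : Type*} [CommRing R] [Algebra ℝ R]
    [AddCommGroup V] [Module ℝ V] [Module R V] [IsScalarTower ℝ R V]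
    [AddCommGroup Ω1] [Module ℝ Ω1] [Module R Ω1] [IsScalarTower ℝ R Ω1]
    [AddCommGroup Ω2] [Module ℝ Ω2] [Module R Ω2] [IsScalarTower ℝ R Ω2]
    [AddCommGroup Ω3] [Module ℝ Ω3] [Module R Ω3] [IsScalarTower ℝ R Ω3]
    (C : CartanCalculus R V Ω1 Ω2 Ω3)


namespace CartanCalculus

theorem d0_one : C.d0 1 = 0 := by
  have h := C.d0_mul 1 1
  simpa using h

theorem d0_inv {a b : R} (hab : a * b = 1) : C.d0 b = -(b • b • C.d0 a) := by
  have h := C.d0_mul a b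
  rw [hab, C.d0_one] at h
  have h2 : b • (a • C.d0 b) = C.d0 b := by rw [smul_smul, mul_comm, hab, one_smul]
  have h3 : b • (a • C.d0 b + b • C.d0 a) = 0 := by rw [← h, smul_zero]
  rw [smul_add, h2] at h3
  exact eq_neg_of_add_eq_zero_left h3

theorem w11_self (α : Ω1) : C.w11 α α = 0 := by
  have h := C.w11_skew α α
  have h2 : (2 : ℝ) • C.w11 α α = 0 := by
    rw [two_smul]
    nth_rewrite 1 [h]
    simp
  exact (smul_eq_zero.mp h2).resolve_left two_ne_zero

/-- The logarithmic differential of an invertible function is closed. -/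
theorem d1_inv_smul_d0 {a b : R} (hab : a * b = 1) : C.d1 (b • C.d0 a) = 0 := by
  rw [C.d1_smul, C.d1_d0, C.d0_inv hab, smul_smul, map_neg, LinearMap.neg_apply,
    C.w11_smul_left, C.w11_self]
  simp

theorem lieD_smul (X : V) (f : R) (α : Ω1) :
    C.lieD X (f • α) = f • C.lieD X α + C.ι1 X (C.d0 f) • α := by
  simp only [lieD, C.ι1_smul_right, C.d0_mul, C.d1_smul, map_add, C.ι2_smul_right, C.ι2_w11]
  module

theorem lieD_sub (X : V) (α β : Ω1) : C.lieD X (α - β) = C.lieD X α - C.lieD X β := by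
  simp only [lieD, map_sub]
  abel

theorem twistFun_add (a : R) (Y : V) (e e' : (V × R) × (Ω1 × R)) :
    C.twistFun a Y (e + e') = C.twistFun a Y e + C.twistFun a Y e' := by
  ext
  · simp only [twistFun, Prod.fst_add, Prod.snd_add]
    module
  · simp only [twistFun, Prod.fst_add, Prod.snd_add, map_add]
    ring
  · rfl
  · rfl

theorem twistFun_smul (a r : R) (Y : V) (e : (V × R) × (Ω1 × R)) :
    C.twistFun a Y (r • e) = r • C.twistFun a Y e := by
  ext
  · simp only [twistFun, Prod.smul_fst, Prod.smul_snd, smul_eq_mul]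
    module
  · simp only [twistFun, Prod.smul_fst, Prod.smul_snd, smul_eq_mul, C.ι1_smul_right]
    ring
  · rfl
  · rfl

theorem mem_conf {L : Submodule R ((V × R) × (Ω1 × R))} {a : R} {Y : V}
    {e : (V × R) × (Ω1 × R)} : e ∈ C.conf L a Y ↔ ∃ e' ∈ L, C.twistFun a Y e' = e := by
  let T : ((V × R) × (Ω1 × R)) →ₗ[R] ((V × R) × (Ω1 × R)) :=
    { toFun := C.twistFun a Y
      map_add' := C.twistFun_add a Y
      map_smul' := fun r e => C.twistFun_smul a r Y e }
  have h : C.conf L a Y = L.map T := by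
    rw [← Submodule.span_eq (L.map T), Submodule.map_coe]
    rfl
  rw [h, Submodule.mem_map]
  rfl

theorem pairPlusE_twistFun (a : R) (Y : V) (e e' : (V × R) × (Ω1 × R)) :
    C.pairPlusE (C.twistFun a Y e) (C.twistFun a Y e') = a * C.pairPlusE e e' := by
  simp only [pairPlusE, twistFun, map_add, LinearMap.add_apply, C.ι1_smul_left, mul_smul_comm]
  congr 1
  ring

theorem twistFun_surjective {a b : R} (hab : a * b = 1) (Y : V) :
    Function.Surjective (C.twistFun a Y) := by
  intro e
  refine ⟨((b • (e.1.1 - e.2.2 • Y), b * (e.1.2 + C.ι1 Y e.2.1)), e.2), ?_⟩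
  ext
  · simp only [twistFun, smul_smul, hab]
    module
  · simp only [twistFun, ← mul_assoc, hab]
    ring
  · rfl
  · rfl

theorem IsMaxIsotropicE.conf {C : CartanCalculus R V Ω1 Ω2 Ω3}
    {L : Submodule R ((V × R) × (Ω1 × R))} (hL : C.IsMaxIsotropicE L)
    {a b : R} (hab : a * b = 1) (Y : V) : C.IsMaxIsotropicE (C.conf L a Y) := by
  refine ⟨fun e he e' he' => ?_, fun e he => ?_⟩
  · obtain ⟨s, hs, rfl⟩ := C.mem_conf.mp he
    obtain ⟨s', hs', rfl⟩ := C.mem_conf.mp he'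
    rw [C.pairPlusE_twistFun, hL.1 s hs s' hs', mul_zero]
  · obtain ⟨s, rfl⟩ := C.twistFun_surjective hab Y e
    refine C.mem_conf.mpr ⟨s, hL.2 s fun s' hs' => ?_, rfl⟩
    have h := he _ (C.mem_conf.mpr ⟨s', hs', rfl⟩)
    rw [C.pairPlusE_twistFun] at h
    calc C.pairPlusE s s' = b * (a * C.pairPlusE s s') := by
          rw [← mul_assoc, mul_comm b, hab, one_mul]
      _ = 0 := by rw [h, mul_zero]

/-- The automorphism of `E^1(M)` induced by changing the trivialization of the trivial line
bundle by an invertible function with inverse `b` and logarithmic differential `u`. -/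
def gauge (b : R) (u : Ω1) (e : (V × R) × (Ω1 × R)) : (V × R) × (Ω1 × R) :=
  ((e.1.1, e.1.2 + C.ι1 e.1.1 u), (b • (e.2.1 - e.2.2 • u), b * e.2.2))

theorem ebracket_gauge {b : R} {u : Ω1} (hb : C.d0 b = -(b • u)) (hu : C.d1 u = 0)
    (e e' : (V × R) × (Ω1 × R)) :
    C.ebracket (C.gauge b u e) (C.gauge b u e') = C.gauge b u (C.ebracket e e') := by
  obtain ⟨⟨X, φ⟩, α, g⟩ := e
  obtain ⟨⟨X', φ'⟩, α', g'⟩ := e'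
  obtain ⟨h, hh⟩ : ∃ h : R, h = algebraMap ℝ R 2⁻¹ := ⟨_, rfl⟩
  have h2 : 2 * h = 1 := by
    rw [hh, ← map_ofNat (algebraMap ℝ R) 2, ← map_mul]
    norm_num
  have hR (x : R) : (2⁻¹ : ℝ) • x = h * x := by rw [hh, Algebra.smul_def]
  have hΩ (x : Ω1) : (2⁻¹ : ℝ) • x = h • x := by rw [hh, algebraMap_smul]
  have hlie (Z : V) : C.lieD Z u = C.d0 (C.ι1 Z u) := by simp [lieD, hu]
  have hev := C.eval_d1 X X' u
  rw [hu] at hev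
  simp only [map_zero] at hev
  ext
  · rfl
  · simp only [gauge, ebracket, Xdot, map_add]
    linear_combination -hev
  · simp only [gauge, ebracket, Xdot, hR, hΩ, C.lieD_smul, C.lieD_sub, hlie, hb, C.d0_mul,
      C.ι1_smul_right, map_add, map_sub, map_neg]
    linear_combination (norm := module)
      h2 • b • (g' • C.d0 (C.ι1 X u) - g • C.d0 (C.ι1 X' u) + (φ * g' - φ' * g) • u)
  · simp only [gauge, ebracket, Xdot, hR, hb, C.d0_mul, C.ι1_smul_right, map_add, map_sub,
      map_neg]
    linear_combination b * (g' * C.ι1 X u - g * C.ι1 X' u) * h2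

/-- On an isotropic `L` containing `e_a = (Y, θ) + (da, 0)`, the `(a, Y)`-twist is the gauge
transformation by `a` of `a e + f e_a`. -/
theorem gauge_smul_add_smul {L : Submodule R ((V × R) × (Ω1 × R))} (hL : C.IsIsotropicE L)
    {a b : R} (hab : a * b = 1) {Y : V} {θ : R} (hea : ((Y, θ), (C.d0 a, (0 : R))) ∈ L)
    {e : (V × R) × (Ω1 × R)} (he : e ∈ L) :
    C.gauge b (b • C.d0 a) (a • e + e.2.2 • ((Y, θ), (C.d0 a, (0 : R)))) =
      C.twistFun a Y e := by
  have h2 {x : R} (h : (2⁻¹ : ℝ) • x = 0) : x = 0 :=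
    (smul_eq_zero.mp h).resolve_left (by norm_num)
  have hpair := h2 (hL _ he _ hea)
  have hself := h2 (hL _ hea _ hea)
  simp only at hpair hself
  have hY : C.ι1 Y (C.d0 a) = 0 := by
    have : (2 : ℝ) • C.ι1 Y (C.d0 a) = 0 := by
      rw [two_smul]
      simpa using hself
    exact (smul_eq_zero.mp this).resolve_left two_ne_zero
  obtain ⟨⟨X, φ⟩, α, f⟩ := e
  simp only at hpair
  ext
  · rfl
  · simp only [gauge, twistFun, Prod.smul_mk, Prod.mk_add_mk, smul_eq_mul, map_add,
      LinearMap.add_apply, C.ι1_smul_left, C.ι1_smul_right, hY]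
    linear_combination C.ι1 X (C.d0 a) * hab + hpair
  · simp only [gauge, twistFun, Prod.smul_mk, Prod.mk_add_mk, smul_eq_mul, mul_zero, add_zero]
    linear_combination (norm := module) hab • α - (f * b) • hab • C.d0 a
  · simp only [gauge, twistFun, Prod.smul_mk, Prod.mk_add_mk, smul_eq_mul]
    linear_combination f * hab

end CartanCalculus

/-- Theorem 6.2: let `L` be a Dirac structure of `E^1(M)`
whose sections are spanned by elements of the form `(X_f,φ_f)+(df,f)`, let
`a` be nowhere vanishing (invertible) with `(Y_a,θ_a)+(da,0) ∈ Γ(L)`, and let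
`L^a` be the sub-bundle spanned by
`{(aX + f Y_a, aφ − i_{Y_a} α) + (α,f) | (X,φ)+(α,f) ∈ Γ(L)}`.
Then `L^a` is a Dirac structure of `E^1(M)`. -/
theorem conf_dirac (L : Submodule R ((V × R) × (Ω1 × R))) (hL : C.IsDiracE L)
    (hspan : L = Submodule.span R
        {e : (V × R) × (Ω1 × R) | e ∈ L ∧ e.2.1 = C.d0 e.2.2})
    (a ainv : R) (ha : a * ainv = 1)
    (Ya : V) (θa : R) (hea : ((Ya, θa), (C.d0 a, (0 : R))) ∈ L) :
    C.IsDiracE (C.conf L a Ya) := by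
  have hS {e} (he : e ∈ L) : a • e + e.2.2 • ((Ya, θa), (C.d0 a, (0 : R))) ∈ L :=
    L.add_mem (L.smul_mem _ he) (L.smul_mem _ hea)
  have hb : C.d0 ainv = -(ainv • ainv • C.d0 a) := C.d0_inv ha
  refine ⟨hL.1.conf ha Ya, fun e he e' he' => ?_⟩
  obtain ⟨s, hs, rfl⟩ := C.mem_conf.mp he
  obtain ⟨s', hs', rfl⟩ := C.mem_conf.mp he'
  rw [← C.gauge_smul_add_smul hL.1.1 ha hea hs, ← C.gauge_smul_add_smul hL.1.1 ha hea hs',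
    C.ebracket_gauge hb (C.d1_inv_smul_d0 ha)]
  have hmem := hL.2 _ (hS hs) _ (hS hs')
  set t := C.ebracket (a • s + s.2.2 • ((Ya, θa), (C.d0 a, (0 : R))))
    (a • s' + s'.2.2 • ((Ya, θa), (C.d0 a, (0 : R))))
  have hr : ainv • t - (ainv * ainv * t.2.2) • ((Ya, θa), (C.d0 a, (0 : R))) ∈ L :=
    L.sub_mem (L.smul_mem _ hmem) (L.smul_mem _ hea)
  refine C.mem_conf.mpr ⟨_, hr, ?_⟩
  rw [← C.gauge_smul_add_smul hL.1.1 ha hea hr]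
  congr 1
  simp only [Prod.snd_sub, Prod.smul_snd, smul_eq_mul, mul_zero, sub_zero]
  linear_combination (norm := module) ha • t -
    (ainv * t.2.2) • ha • (((Ya, θa), (C.d0 a, (0 : R))) : (V × R) × (Ω1 × R))

end ConformalDirac
end
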